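/- Let p > q > 0 be integers and let L be a lattice segment such that 𝒴^{p,q} + L is a toric diagram. Then 𝒴^{p,q} + L admits a lattice maximal Minkowski decomposition if and only if either (q = 1 and L is a translate of conv{(0,0),(1,1)}) or (p − q is odd and L is a translate of conv{(0,0),(−p+q+2,−p+q)}); in both cases 𝒴^{p,q} + L is the Minkowski sum of two lattice triangles. -/

import Mathlib

open Set Pointwise

noncomputable section

/-- We work in the plane `ℝ × ℝ`. -/
abbrev V : Type := ℝ × ℝ

/-- The embedding of the lattice `ℤ × ℤ` into the plane. -/
def toR (p : ℤ × ℤ) : V := ((p.1 : ℝ), (p.2 : ℝ))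

/-- The set of lattice points of the plane. -/
def latticePoints : Set V := Set.range toR

/-- A lattice polytope: the convex hull of a nonempty finite set of lattice points. -/
def IsLatticePolytope (P : Set V) : Prop :=
  ∃ S : Finset (ℤ × ℤ), S.Nonempty ∧ P = convexHull ℝ (toR '' ↑S)

/-- A toric diagram: a two-dimensional lattice polytope such that every lattice point on its
topological boundary is an extreme point. -/
def IsToricDiagram (P : Set V) : Prop :=
  IsLatticePolytope P ∧ (interior P).Nonempty ∧
    ∀ x ∈ frontier P, x ∈ latticePoints → x ∈ P.extremePoints ℝ

/-- A lattice segment: the convex hull of two distinct lattice points. -/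
def IsLatticeSegment (L : Set V) : Prop :=
  ∃ a b : ℤ × ℤ, a ≠ b ∧ L = segment ℝ (toR a) (toR b)

/-- A lattice triangle: the convex hull of three affinely independent lattice points. -/
def IsLatticeTriangle (T : Set V) : Prop :=
  ∃ a b c : ℤ × ℤ, AffineIndependent ℝ ![toR a, toR b, toR c] ∧
    T = convexHull ℝ {toR a, toR b, toR c}

/-- `E` is an edge of `P`: a maximal (nondegenerate) line segment contained in the
topological boundary of `P`. -/
def IsEdge (P E : Set V) : Prop :=
  (∃ a b : V, a ≠ b ∧ E = segment ℝ a b) ∧ E ⊆ frontier P ∧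
    ∀ F : Set V, (∃ a b : V, F = segment ℝ a b) → F ⊆ frontier P → E ⊆ F → F = E

/-- `v` is an edge vector of `P` (the difference of the endpoints of some edge of `P`). -/
def IsEdgeVector (P : Set V) (v : V) : Prop :=
  ∃ a b : V, a ≠ b ∧ IsEdge P (segment ℝ a b) ∧ v = b - a

/-- Two plane vectors are parallel when their cross product vanishes. -/
def Par (v w : V) : Prop := v.1 * w.2 = v.2 * w.1

/-- `P` admits a lattice maximal Minkowski decomposition: `P` is a Minkowski sum of at
least two lattice polytopes, each of which is a lattice segment or a lattice triangle. -/
def HasLatticeMaximalDecomposition (P : Set V) : Prop :=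
  ∃ (m : ℕ) (Ps : Fin (m + 1) → Set V), 1 ≤ m ∧
    P = ∑ k, Ps k ∧ ∀ k, IsLatticeSegment (Ps k) ∨ IsLatticeTriangle (Ps k)

/-- A convex polytope: the convex hull of a nonempty finite set of points. -/
def IsConvexPolytope (A : Set V) : Prop :=
  ∃ S : Finset V, S.Nonempty ∧ A = convexHull ℝ (↑S : Set V)

/-- `A` is a homothet `λ • P + t` (`λ > 0`) of `P`. -/
def IsHomothet (A P : Set V) : Prop :=
  ∃ (l : ℝ) (t : V), 0 < l ∧ A = (fun x => l • x + t) '' P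

/-- A (nondegenerate) line segment. -/
def IsSegmentSet (A : Set V) : Prop := ∃ a b : V, a ≠ b ∧ A = segment ℝ a b

/-- A triangle: the convex hull of three affinely independent points. -/
def IsTriangleSet (A : Set V) : Prop :=
  ∃ a b c : V, AffineIndependent ℝ ![a, b, c] ∧ A = convexHull ℝ {a, b, c}

/-- A convex polytope is Minkowski-indecomposable if in every Minkowski decomposition
into two convex polytopes, one of the summands is a point or a homothet of the polytope. -/
def MinkowskiIndecomposable (Q : Set V) : Prop :=
  ∀ A B : Set V, IsConvexPolytope A → IsConvexPolytope B → Q = A + B →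
    (∃ x, A = {x}) ∨ IsHomothet A Q ∨ (∃ x, B = {x}) ∨ IsHomothet B Q

/-- A parallelogram: a quadrilateral whose vertices `v₁ v₂ v₃ v₄` in cyclic order satisfy
`v₁ + v₃ = v₂ + v₄`. -/
def IsParallelogram (P : Set V) : Prop :=
  ∃ w : Fin 4 → V, Function.Injective w ∧ P.extremePoints ℝ = Set.range w ∧
    w 0 + w 2 = w 1 + w 3

/-- The Gauntlett–Martelli–Sparks–Waldram toric diagram `𝒴^{p,q}`. -/
def GMSW (p q : ℤ) : Set V :=
  convexHull ℝ (toR '' ({(0, 0), (1, 0), (p, p), (p - q - 1, p - q)} : Set (ℤ × ℤ)))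

/-- Cross product of lattice vectors. -/
def crossZ (u w : ℤ × ℤ) : ℤ := u.1 * w.2 - u.2 * w.1

/-! ### The cross product and supporting lines -/

/-- Cross product of plane vectors. -/
def planeCross (u w : V) : ℝ := u.1 * w.2 - u.2 * w.1

lemma planeCross_toR (d x : ℤ × ℤ) : planeCross (toR d) (toR x) = (crossZ d x : ℝ) := by
  simp [planeCross, toR, crossZ]

lemma planeCross_add (d x y : V) : planeCross d (x + y) = planeCross d x + planeCross d y := by
  simp only [planeCross, Prod.fst_add, Prod.snd_add]; ring

lemma planeCross_smul (d : V) (t : ℝ) (x : V) : planeCross d (t • x) = t * planeCross d x := by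
  simp only [planeCross, Prod.smul_fst, Prod.smul_snd, smul_eq_mul]; ring

lemma toR_add (x y : ℤ × ℤ) : toR (x + y) = toR x + toR y := by
  simp [toR]

lemma toR_injective : Function.Injective toR := by
  rintro ⟨a, b⟩ ⟨c, d⟩ h
  simpa [toR] using h

lemma toR_eq_zero {x : ℤ × ℤ} : toR x = 0 ↔ x = 0 := by
  have h : toR 0 = 0 := by ext <;> simp [toR]
  rw [← h]
  exact toR_injective.eq_iff

lemma normSq_pos {d : V} (hd : d ≠ 0) : 0 < d.1 ^ 2 + d.2 ^ 2 := by
  by_contra! h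
  refine hd (Prod.ext ?_ ?_) <;> simp only [Prod.fst_zero, Prod.snd_zero] <;>
    nlinarith [sq_nonneg d.1, sq_nonneg d.2]

lemma exists_smul_of_planeCross_eq_zero {d v : V} (hd : d ≠ 0) (h : planeCross d v = 0) :
    ∃ t : ℝ, v = t • d := by
  have hs := (normSq_pos hd).ne'
  refine ⟨(d.1 * v.1 + d.2 * v.2) / (d.1 ^ 2 + d.2 ^ 2), ?_⟩
  simp only [planeCross] at h
  ext <;> simp only [Prod.smul_fst, Prod.smul_snd, smul_eq_mul] <;> field_simp
  · linear_combination (-d.2) * h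
  · linear_combination d.1 * h

lemma le_planeCross_of_mem_convexHull {S : Set V} {d : V} {c : ℝ} (h : ∀ z ∈ S, c ≤ planeCross d z)
    {z : V} (hz : z ∈ convexHull ℝ S) : c ≤ planeCross d z :=
  convexHull_min (t := {w | c ≤ planeCross d w}) h
    (convex_halfSpace_ge (IsLinearMap.mk (planeCross_add d) (planeCross_smul d)) c) hz

/-- A point of `Q` minimising a nonzero linear functional lies on the boundary. -/
lemma mem_frontier_of_planeCross_min {Q : Set V} {d X : V} (hd : d ≠ 0) (hX : X ∈ Q)
    (hmin : ∀ z ∈ Q, planeCross d X ≤ planeCross d z) : X ∈ frontier Q := by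
  refine ⟨subset_closure hX, fun hint => ?_⟩
  have hc : Continuous fun t : ℝ => X + t • ((d.2, -d.1) : V) := by fun_prop
  have hev : ∀ᶠ t : ℝ in nhds 0, X + t • ((d.2, -d.1) : V) ∈ interior Q :=
    hc.continuousAt.eventually_mem (isOpen_interior.mem_nhds (by simpa using hint))
  obtain ⟨t, ht, ht0⟩ :=
    ((hev.filter_mono (nhdsWithin_le_nhds (s := Ioi 0))).and self_mem_nhdsWithin).exists
  have h := hmin _ (interior_subset ht)
  rw [planeCross_add, planeCross_smul] at h
  have hs := normSq_pos hd
  have : 0 < t * (d.1 ^ 2 + d.2 ^ 2) := mul_pos ht0 hs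
  simp only [planeCross] at h
  nlinarith

lemma not_extreme_of_between {Q : Set V} {X d : V} {r s t : ℝ} (hd : d ≠ 0)
    (hrs : r < s) (hst : s < t) (hr : X + r • d ∈ Q) (ht : X + t • d ∈ Q)
    (hs : X + s • d ∈ Q.extremePoints ℝ) : False := by
  have hrt : 0 < t - r := by linarith
  have hmem : X + s • d ∈ openSegment ℝ (X + r • d) (X + t • d) := by
    refine ⟨(t - s) / (t - r), (s - r) / (t - r), div_pos (by linarith) hrt,
      div_pos (by linarith) hrt, by field_simp; ring, ?_⟩
    ext <;> simp only [Prod.smul_fst, Prod.smul_snd, Prod.fst_add, Prod.snd_add, smul_eq_mul] <;>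
      field_simp <;> ring
  have h := hs.2 hr ht hmem
  have h' : (s - r) • d = 0 := by
    rw [sub_smul, sub_eq_zero]
    exact (add_left_cancel h).symm
  rcases smul_eq_zero.1 h' with h0 | h0
  · linarith
  · exact hd h0

/-- A supporting line of a toric diagram contains at most two of its lattice points. -/
lemma IsToricDiagram.eq_of_supporting_line {Q : Set V} (hQ : IsToricDiagram Q) {d : V}
    (hd : d ≠ 0) {X Y Z : ℤ × ℤ} (hX : toR X ∈ Q) (hY : toR Y ∈ Q) (hZ : toR Z ∈ Q)
    (hmin : ∀ z ∈ Q, planeCross d (toR X) ≤ planeCross d z)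
    (hXY : planeCross d (toR Y) = planeCross d (toR X))
    (hXZ : planeCross d (toR Z) = planeCross d (toR X)) : X = Y ∨ Y = Z ∨ X = Z := by
  have hext : ∀ W : ℤ × ℤ, toR W ∈ Q → planeCross d (toR W) = planeCross d (toR X) →
      toR W ∈ Q.extremePoints ℝ := fun W hW h =>
    hQ.2.2 _ (mem_frontier_of_planeCross_min hd hW (h ▸ hmin)) ⟨W, rfl⟩
  have hpar : ∀ W : ℤ × ℤ, planeCross d (toR W) = planeCross d (toR X) →
      ∃ t : ℝ, toR W = toR X + t • d := fun W h => by
    obtain ⟨t, ht⟩ := exists_smul_of_planeCross_eq_zero (v := toR W - toR X) hd (by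
      simp only [planeCross, Prod.fst_sub, Prod.snd_sub] at h ⊢; linarith)
    exact ⟨t, by rw [← ht]; abel⟩
  obtain ⟨s, hs⟩ := hpar Y hXY
  obtain ⟨t, ht⟩ := hpar Z hXZ
  have h0 : toR X = toR X + (0 : ℝ) • d := by simp
  have eX := hext X hX rfl
  have eY := hext Y hY hXY
  have eZ := hext Z hZ hXZ
  by_contra! hne
  have hs0 : s ≠ 0 := fun h => hne.1 (toR_injective (by rw [hs, h]; simp))
  have ht0 : t ≠ 0 := fun h => hne.2.2 (toR_injective (by rw [ht, h]; simp))
  have hst : s ≠ t := fun h => hne.2.1 (toR_injective (by rw [hs, ht, h]))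
  rw [h0] at hX eX
  rw [hs] at hY eY
  rw [ht] at hZ eZ
  rcases hs0.lt_or_gt with h1 | h1 <;> rcases ht0.lt_or_gt with h2 | h2 <;>
    rcases hst.lt_or_gt with h3 | h3
  · exact not_extreme_of_between hd h3 h2 hY hX eZ
  · exact not_extreme_of_between hd h3 h1 hZ hX eY
  · exact not_extreme_of_between hd h1 h2 hY hZ eX
  · linarith
  · linarith
  · exact not_extreme_of_between hd h2 h1 hZ hY eX
  · exact not_extreme_of_between hd h1 h3 hX hZ eY
  · exact not_extreme_of_between hd h2 h3 hX hY eZ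

/-! ### Lattice edges of Minkowski sums -/

/-- `d` is a lattice vector along the boundary of `K`, with `K` on its left. -/
def IsLatticeEdge (K : Set V) (d : ℤ × ℤ) : Prop :=
  ∃ x : ℤ × ℤ, toR x ∈ K ∧ toR (x + d) ∈ K ∧
    ∀ z ∈ K, planeCross (toR d) (toR x) ≤ planeCross (toR d) z

/-- Every linear functional attains its minimum over `K` at a lattice point of `K`. -/
def HasLatticeMin (K : Set V) : Prop :=
  ∀ d : V, ∃ x : ℤ × ℤ, toR x ∈ K ∧ ∀ z ∈ K, planeCross d (toR x) ≤ planeCross d z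

lemma IsLatticePolytope.hasLatticeMin {K : Set V} (hK : IsLatticePolytope K) :
    HasLatticeMin K := by
  obtain ⟨S, hS, rfl⟩ := hK
  intro d
  obtain ⟨x, hx, hmin⟩ := S.exists_min_image (fun x => planeCross d (toR x)) hS
  refine ⟨x, subset_convexHull ℝ _ ⟨x, hx, rfl⟩, fun z hz => le_planeCross_of_mem_convexHull ?_ hz⟩
  rintro _ ⟨y, hy, rfl⟩
  exact hmin y hy

lemma IsLatticeSegment.isLatticePolytope {K : Set V} (hK : IsLatticeSegment K) :
    IsLatticePolytope K := by
  obtain ⟨a, b, -, rfl⟩ := hK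
  exact ⟨{a, b}, by simp, by simp [image_insert_eq, convexHull_pair]⟩

lemma IsLatticeTriangle.isLatticePolytope {K : Set V} (hK : IsLatticeTriangle K) :
    IsLatticePolytope K := by
  obtain ⟨a, b, c, -, rfl⟩ := hK
  exact ⟨{a, b, c}, by simp, by simp [image_insert_eq]⟩

lemma gmsw_isLatticePolytope (p q : ℤ) : IsLatticePolytope (GMSW p q) :=
  ⟨{(0, 0), (1, 0), (p, p), (p - q - 1, p - q)}, by simp, by simp [GMSW]⟩

lemma HasLatticeMin.add {A B : Set V} (hA : HasLatticeMin A) (hB : HasLatticeMin B) :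
    HasLatticeMin (A + B) := by
  intro d
  obtain ⟨x, hx, hxm⟩ := hA d
  obtain ⟨y, hy, hym⟩ := hB d
  refine ⟨x + y, toR_add x y ▸ add_mem_add hx hy, ?_⟩
  rintro _ ⟨u, hu, v, hv, rfl⟩
  rw [toR_add, planeCross_add, planeCross_add]
  exact add_le_add (hxm u hu) (hym v hv)

lemma HasLatticeMin.sum {ι : Type*} (s : Finset ι) (Ps : ι → Set V)
    (h : ∀ i ∈ s, HasLatticeMin (Ps i)) : HasLatticeMin (∑ i ∈ s, Ps i) := by
  refine Finset.sum_induction _ _ (fun _ _ => HasLatticeMin.add) (fun d => ⟨0, ?_, ?_⟩) h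
  · simp [toR_eq_zero]
  · intro z hz
    rw [Set.mem_zero.1 hz, toR_eq_zero.2 rfl]

lemma IsLatticeEdge.add {A B : Set V} {d : ℤ × ℤ} (hA : IsLatticeEdge A d)
    (hB : HasLatticeMin B) : IsLatticeEdge (A + B) d := by
  obtain ⟨x, hx, hxd, hxm⟩ := hA
  obtain ⟨y, hy, hym⟩ := hB (toR d)
  refine ⟨x + y, toR_add x y ▸ add_mem_add hx hy, ?_, ?_⟩
  · rw [add_right_comm, toR_add]
    exact add_mem_add hxd hy
  · rintro _ ⟨u, hu, v, hv, rfl⟩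
    rw [toR_add, planeCross_add, planeCross_add]
    exact add_le_add (hxm u hu) (hym v hv)

lemma isLatticeEdge_segment (a b : ℤ × ℤ) : IsLatticeEdge (segment ℝ (toR a) (toR b)) (b - a) := by
  refine ⟨a, left_mem_segment _ _ _, by simpa using right_mem_segment _ _ _, fun z hz => ?_⟩
  rw [← convexHull_pair] at hz
  refine le_planeCross_of_mem_convexHull ?_ hz
  rintro _ (rfl | rfl) <;>
    simp only [planeCross_toR, crossZ, Int.cast_le, Prod.fst_sub, Prod.snd_sub] <;>
    nlinarith

lemma isLatticeEdge_triangle {a b c : ℤ × ℤ} (h : 0 < crossZ (b - a) (c - a)) :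
    IsLatticeEdge (convexHull ℝ {toR a, toR b, toR c}) (b - a) := by
  refine ⟨a, subset_convexHull ℝ _ (by simp), subset_convexHull ℝ _ (by simp), fun z hz => ?_⟩
  refine le_planeCross_of_mem_convexHull ?_ hz
  simp only [crossZ, Prod.fst_sub, Prod.snd_sub] at h
  rintro _ (rfl | rfl | rfl) <;>
    simp only [planeCross_toR, crossZ, Int.cast_le, Prod.fst_sub, Prod.snd_sub] <;> nlinarith

lemma affineIndependent_iff_crossZ (a b c : ℤ × ℤ) :
    AffineIndependent ℝ ![toR a, toR b, toR c] ↔ crossZ (b - a) (c - a) ≠ 0 := by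
  rw [affineIndependent_iff_not_collinear_set, not_iff_not,
    collinear_iff_of_mem (p₀ := toR a) (by simp)]
  constructor
  · rintro ⟨v, hv⟩
    obtain ⟨r, hr⟩ := hv (toR b) (by simp)
    obtain ⟨s, hs⟩ := hv (toR c) (by simp)
    have h1 := congrArg Prod.fst hr
    have h2 := congrArg Prod.snd hr
    have h3 := congrArg Prod.fst hs
    have h4 := congrArg Prod.snd hs
    simp [toR] at h1 h2 h3 h4
    have : (crossZ (b - a) (c - a) : ℝ) = 0 := by
      simp only [crossZ, Prod.fst_sub, Prod.snd_sub]
      push_cast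
      rw [h1, h2, h3, h4]; ring
    exact_mod_cast this
  · intro h
    by_cases hab : b = a
    · refine ⟨toR c - toR a, ?_⟩
      rintro _ (rfl | rfl | rfl)
      · exact ⟨0, by simp⟩
      · exact ⟨0, by simp [hab]⟩
      · exact ⟨1, by simp⟩
    · obtain ⟨t, ht⟩ := exists_smul_of_planeCross_eq_zero (d := toR (b - a)) (v := toR (c - a))
        (by rwa [Ne, toR_eq_zero, sub_eq_zero]) (by rw [planeCross_toR, h]; simp)
      have hsub : ∀ x : ℤ × ℤ, toR x = toR (x - a) + toR a := fun x => by
        rw [← toR_add, sub_add_cancel]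
      refine ⟨toR (b - a), ?_⟩
      rintro _ (rfl | rfl | rfl)
      · exact ⟨0, by simp⟩
      · exact ⟨1, by simpa using hsub b⟩
      · exact ⟨t, by rw [← ht]; exact hsub c⟩

/-- The face of a triangle with only the vertex `a` at minimal height is `{a}`. -/
lemma eq_vertex_of_mem_triangle {a b c x : V} (hx : x ∈ convexHull ℝ {a, b, c})
    (hb : x.2 < b.2) (hc : x.2 < c.2) (ha : x.2 ≤ a.2) : x = a := by
  rw [convexHull_insert (by simp), convexHull_pair, mem_convexJoin] at hx
  simp only [mem_singleton_iff, exists_eq_left] at hx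
  obtain ⟨y, ⟨r, s, hr, hs, hrs, rfl⟩, ⟨t, u, ht, hu, htu, rfl⟩⟩ := hx
  simp only [Prod.smul_snd, Prod.snd_add, smul_eq_mul] at hb hc ha
  set m := t * a.2 + u * (r * b.2 + s * c.2) with hm
  clear_value m
  have hy : m < r * b.2 + s * c.2 := by
    rcases hr.lt_or_eq with h | h
    · have h₁ := mul_pos h (sub_pos.2 hb)
      have h₂ := mul_nonneg hs (sub_pos.2 hc).le
      linear_combination h₁ + h₂ - m * hrs
    · obtain rfl : s = 1 := by linarith
      rw [← h]; linarith
  have hu0 : u = 0 := by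
    by_contra h
    have h₁ := mul_pos (lt_of_le_of_ne hu (Ne.symm h)) (sub_pos.2 hy)
    have h₂ := mul_nonneg ht (sub_nonneg.2 ha)
    have h₃ : t * m + u * m = m := by rw [← add_mul, htu, one_mul]
    linarith
  obtain rfl : t = 1 := by linarith
  simp [hu0]

/-- The boundary of a triangle whose side `a b` is horizontal and lowest. -/
lemma exists_edges_of_horizontal_side {a b c : ℤ × ℤ} (h : crossZ (b - a) (c - a) ≠ 0)
    (hab : a.2 = b.2) (hac : a.2 ≤ c.2) :
    ∃ d₁ d₂ d₃ : ℤ × ℤ, d₁ + d₂ + d₃ = 0 ∧ d₁.2 = 0 ∧ d₁ ≠ 0 ∧ d₂ ≠ 0 ∧ d₃ ≠ 0 ∧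
      IsLatticeEdge (convexHull ℝ {toR a, toR b, toR c}) d₁ ∧
      IsLatticeEdge (convexHull ℝ {toR a, toR b, toR c}) d₂ ∧
      IsLatticeEdge (convexHull ℝ {toR a, toR b, toR c}) d₃ := by
  wlog hlt : a.1 < b.1 generalizing a b
  · have h' : crossZ (a - b) (c - b) ≠ 0 := fun h0 => h (by
      simp only [crossZ, Prod.fst_sub, Prod.snd_sub] at h0 ⊢; linarith)
    have hne : a.1 ≠ b.1 := fun h0 => h (by
      simp only [crossZ, Prod.fst_sub, Prod.snd_sub, h0, hab]; ring)
    rw [insert_comm]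
    exact this h' hab.symm (hab ▸ hac) (by omega)
  have hpos : 0 < crossZ (b - a) (c - a) := by
    refine lt_of_le_of_ne ?_ h.symm
    simp only [crossZ, Prod.fst_sub, Prod.snd_sub]
    rw [hab] at hac ⊢
    nlinarith
  have hpos₂ : 0 < crossZ (c - b) (a - b) := by
    simp only [crossZ, Prod.fst_sub, Prod.snd_sub] at hpos ⊢; linarith
  have hpos₃ : 0 < crossZ (a - c) (b - c) := by
    simp only [crossZ, Prod.fst_sub, Prod.snd_sub] at hpos ⊢; linarith
  have e₁ := isLatticeEdge_triangle hpos
  have e₂ := isLatticeEdge_triangle hpos₂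
  have e₃ := isLatticeEdge_triangle hpos₃
  rw [show ({toR b, toR c, toR a} : Set V) = {toR a, toR b, toR c} by
    ext; simp only [mem_insert_iff, mem_singleton_iff]; tauto] at e₂
  rw [show ({toR c, toR a, toR b} : Set V) = {toR a, toR b, toR c} by
    ext; simp only [mem_insert_iff, mem_singleton_iff]; tauto] at e₃
  refine ⟨b - a, c - b, a - c, by abel, by simp [hab], ?_, ?_, ?_, e₁, e₂, e₃⟩
  · rintro h0; simp [h0, crossZ] at hpos
  · rintro h0; simp [h0, crossZ] at hpos₂
  · rintro h0; simp [h0, crossZ] at hpos₃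

/-- A lattice segment or triangle whose lowest face is not a point has a horizontal edge. -/
lemma exists_edges_of_lowest_face {K : Set V} (hK : IsLatticeSegment K ∨ IsLatticeTriangle K)
    {x y : V} (hx : x ∈ K) (hy : y ∈ K) (hxy : x ≠ y) (hxm : ∀ z ∈ K, x.2 ≤ z.2)
    (hym : ∀ z ∈ K, y.2 ≤ z.2) :
    (∃ d : ℤ × ℤ, d.2 = 0 ∧ d ≠ 0 ∧ IsLatticeEdge K d ∧ IsLatticeEdge K (-d)) ∨
    ∃ d₁ d₂ d₃ : ℤ × ℤ, d₁ + d₂ + d₃ = 0 ∧ d₁.2 = 0 ∧ d₁ ≠ 0 ∧ d₂ ≠ 0 ∧ d₃ ≠ 0 ∧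
      IsLatticeEdge K d₁ ∧ IsLatticeEdge K d₂ ∧ IsLatticeEdge K d₃ := by
  have hyx : y.2 = x.2 := le_antisymm (hym x hx) (hxm y hy)
  have key : ∀ a b c : V, K = convexHull ℝ {a, b, c} → ¬(x.2 < b.2 ∧ x.2 < c.2) := by
    rintro a b c hK ⟨hb, hc⟩
    have ha : x.2 ≤ a.2 := hxm a (hK ▸ subset_convexHull ℝ _ (by simp))
    refine hxy ((eq_vertex_of_mem_triangle (hK ▸ hx) hb hc ha).trans
      (eq_vertex_of_mem_triangle (hK ▸ hy) ?_ ?_ ?_).symm) <;> rwa [hyx]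
  have hcast : ∀ {u w : ℤ × ℤ}, (toR u).2 = (toR w).2 → u.2 = w.2 := fun h => by
    simpa [toR] using h
  rcases hK with ⟨a, b, hab, hK⟩ | ⟨a, b, c, hind, hK⟩
  · left
    have hma := hxm (toR a) (hK ▸ left_mem_segment _ _ _)
    have hmb := hxm (toR b) (hK ▸ right_mem_segment _ _ _)
    have h₁ := key (toR a) (toR b) (toR b) (by rw [hK, ← convexHull_pair]; simp)
    have h₂ := key (toR b) (toR a) (toR a) (by rw [hK, ← convexHull_pair, pair_comm]; simp)
    have hab2 : a.2 = b.2 := hcast (by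
      rw [and_self, not_lt] at h₁ h₂; linarith)
    refine ⟨b - a, by simp [hab2], sub_ne_zero.2 hab.symm, hK ▸ isLatticeEdge_segment a b, ?_⟩
    rw [neg_sub, hK, segment_symm]
    exact isLatticeEdge_segment b a
  · right
    have hma := hxm (toR a) (hK ▸ subset_convexHull ℝ _ (by simp))
    have hmb := hxm (toR b) (hK ▸ subset_convexHull ℝ _ (by simp))
    have hmc := hxm (toR c) (hK ▸ subset_convexHull ℝ _ (by simp))
    have p₁ : ({toR a, toR b, toR c} : Set V) = {toR b, toR c, toR a} := by
      ext; simp only [mem_insert_iff, mem_singleton_iff]; tauto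
    have p₂ : ({toR a, toR b, toR c} : Set V) = {toR c, toR a, toR b} := by
      ext; simp only [mem_insert_iff, mem_singleton_iff]; tauto
    have h₁ := key (toR a) (toR b) (toR c) hK
    have h₂ := key (toR b) (toR c) (toR a) (by rw [hK, p₁])
    have h₃ := key (toR c) (toR a) (toR b) (by rw [hK, p₂])
    rw [affineIndependent_iff_crossZ] at hind
    have hle : ∀ {u w : ℤ × ℤ}, (toR u).2 ≤ x.2 → x.2 ≤ (toR w).2 → u.2 ≤ w.2 := fun h h' => by
      simpa [toR] using h.trans h'
    have two : (a.2 = b.2 ∧ a.2 ≤ c.2) ∨ (b.2 = c.2 ∧ b.2 ≤ a.2) ∨ (c.2 = a.2 ∧ c.2 ≤ b.2) := by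
      by_cases ha : (toR a).2 ≤ x.2 <;> by_cases hb : (toR b).2 ≤ x.2 <;>
        by_cases hc : (toR c).2 ≤ x.2
      all_goals first
        | exact Or.inl ⟨le_antisymm (hle ha hmb) (hle hb hma), hle ha hmc⟩
        | exact Or.inr (Or.inl ⟨le_antisymm (hle hb hmc) (hle hc hmb), hle hb hma⟩)
        | exact Or.inr (Or.inr ⟨le_antisymm (hle hc hma) (hle ha hmc), hle hc hmb⟩)
        | (exfalso; simp only [not_le] at *; tauto)
    rw [hK]
    simp only [crossZ, Prod.fst_sub, Prod.snd_sub] at hind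
    rcases two with ⟨h, h'⟩ | ⟨h, h'⟩ | ⟨h, h'⟩
    · exact exists_edges_of_horizontal_side hind h h'
    · rw [p₁]
      refine exists_edges_of_horizontal_side (fun h0 => hind ?_) h h'
      simp only [crossZ, Prod.fst_sub, Prod.snd_sub] at h0
      linarith
    · rw [p₂]
      refine exists_edges_of_horizontal_side (fun h0 => hind ?_) h h'
      simp only [crossZ, Prod.fst_sub, Prod.snd_sub] at h0
      linarith

lemma snd_le_of_sum_le {ι : Type*} [Fintype ι] {Ps : ι → Set V} {g : ι → V}
    (hg : ∀ i, g i ∈ Ps i) (hmin : ∀ z ∈ ∑ i, Ps i, (∑ i, g i).2 ≤ z.2) (k : ι) {z : V}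
    (hz : z ∈ Ps k) : (g k).2 ≤ z.2 := by
  classical
  have hmem : ∑ i, Function.update g k z i ∈ ∑ i, Ps i := by
    refine Set.finsetSum_mem_finsetSum _ _ _ fun i _ => ?_
    rcases eq_or_ne i k with rfl | h
    · simpa using hz
    · simpa [h] using hg i
  have h := hmin _ hmem
  rw [Finset.sum_update_of_mem (Finset.mem_univ k), ← Finset.add_sum_erase _ g (Finset.mem_univ k),
    Finset.sdiff_singleton_eq_erase] at h
  simp only [Prod.snd_add] at h
  linarith

lemma IsLatticeEdge.sum {ι : Type*} [Fintype ι] {Ps : ι → Set V} (hPs : ∀ i, HasLatticeMin (Ps i))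
    {k : ι} {d : ℤ × ℤ} (h : IsLatticeEdge (Ps k) d) : IsLatticeEdge (∑ i, Ps i) d := by
  classical
  rw [← Finset.add_sum_erase _ Ps (Finset.mem_univ k)]
  exact h.add (HasLatticeMin.sum _ _ fun i _ => hPs i)

/-! ### The polygons `GMSW p q + L` -/

/-- The vertices of `GMSW p q`. -/
def gmswVertices (p q : ℤ) : Set (ℤ × ℤ) := {(0, 0), (1, 0), (p, p), (p - q - 1, p - q)}

lemma toR_mem_gmsw {p q : ℤ} {v : ℤ × ℤ} (hv : v ∈ gmswVertices p q) : toR v ∈ GMSW p q :=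
  subset_convexHull ℝ _ ⟨v, hv, rfl⟩

lemma gmsw_add_segment (p q : ℤ) (a b : ℤ × ℤ) :
    GMSW p q + segment ℝ (toR a) (toR b) =
      convexHull ℝ (toR '' gmswVertices p q + {toR a, toR b}) := by
  rw [convexHull_add, convexHull_pair]; rfl

lemma toR_mem_segment {a b l : ℤ × ℤ} (hl : l ∈ ({a, b} : Set (ℤ × ℤ))) :
    toR l ∈ segment ℝ (toR a) (toR b) := by
  rcases hl with rfl | rfl
  · exact left_mem_segment _ _ _
  · exact right_mem_segment _ _ _

lemma toR_add_mem {p q : ℤ} {a b v l : ℤ × ℤ} (hv : v ∈ gmswVertices p q)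
    (hl : l ∈ ({a, b} : Set (ℤ × ℤ))) :
    toR (v + l) ∈ GMSW p q + segment ℝ (toR a) (toR b) :=
  toR_add v l ▸ add_mem_add (toR_mem_gmsw hv) (toR_mem_segment hl)

lemma exists_vertex_of_extreme {p q : ℤ} {a b x : ℤ × ℤ}
    (hx : toR x ∈ (GMSW p q + segment ℝ (toR a) (toR b)).extremePoints ℝ) :
    ∃ v ∈ gmswVertices p q, ∃ l ∈ ({a, b} : Set (ℤ × ℤ)), x = v + l := by
  rw [gmsw_add_segment] at hx
  obtain ⟨_, ⟨v, hv, rfl⟩, l, hl, h⟩ := extremePoints_convexHull_subset hx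
  rcases hl with rfl | rfl
  · exact ⟨v, hv, a, by simp, toR_injective (by rw [toR_add]; exact h.symm)⟩
  · exact ⟨v, hv, b, by simp, toR_injective (by rw [toR_add]; exact h.symm)⟩

/-- The lattice edges of a toric `GMSW p q + L`. -/
lemma eq_of_isLatticeEdge {p q : ℤ} (hq : 0 < q) (hpq : q < p) {a b : ℤ × ℤ}
    (htd : IsToricDiagram (GMSW p q + segment ℝ (toR a) (toR b))) {d : ℤ × ℤ} (hd : d ≠ 0)
    (h : IsLatticeEdge (GMSW p q + segment ℝ (toR a) (toR b)) d) :
    (d = (1, 0) ∨ d = (p - 1, p) ∨ d = (-q - 1, -q) ∨ d = (q - p + 1, q - p)) ∨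
      d = b - a ∨ d = a - b := by
  have hd' : toR d ≠ 0 := fun h0 => hd (toR_eq_zero.1 h0)
  obtain ⟨x, hx, hxd, hmin⟩ := h
  have hcd : planeCross (toR d) (toR (x + d)) = planeCross (toR d) (toR x) := by
    simp only [planeCross_toR, crossZ, Prod.fst_add, Prod.snd_add]
    push_cast; ring
  obtain ⟨v, hv, l, hl, rfl⟩ := exists_vertex_of_extreme
    (htd.2.2 _ (mem_frontier_of_planeCross_min hd' hx hmin) ⟨x, rfl⟩)
  obtain ⟨v', hv', l', hl', hxd'⟩ := exists_vertex_of_extreme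
    (htd.2.2 _ (mem_frontier_of_planeCross_min hd' hxd (hcd ▸ hmin)) ⟨_, rfl⟩)
  have hdeq : d = (v' - v) + (l' - l) := by
    rw [eq_sub_of_add_eq' hxd']; abel
  by_cases hvv : v = v'
  · right
    subst hvv
    rcases hl with rfl | rfl <;> rcases hl' with rfl | rfl <;> simp_all
  by_cases hll : l = l'
  · left
    subst hll
    have hle : ∀ w ∈ gmswVertices p q, crossZ d v ≤ crossZ d w := fun w hw => by
      have := hmin _ (toR_add_mem hw hl)
      rw [planeCross_toR, planeCross_toR, Int.cast_le] at this
      simp only [crossZ, Prod.fst_add, Prod.snd_add] at this ⊢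
      linarith
    have h₁ := hle (0, 0) (by simp [gmswVertices])
    have h₂ := hle (1, 0) (by simp [gmswVertices])
    have h₃ := hle (p, p) (by simp [gmswVertices])
    have h₄ := hle (p - q - 1, p - q) (by simp [gmswVertices])
    rw [sub_self, add_zero] at hdeq
    subst hdeq
    simp only [crossZ, Prod.fst_sub, Prod.snd_sub] at h₁ h₂ h₃ h₄
    rcases hv with rfl | rfl | rfl | rfl <;> rcases hv' with rfl | rfl | rfl | rfl <;>
      simp only [] at h₁ h₂ h₃ h₄ <;>
      first
      | exact absurd rfl hvv
      | (exfalso; linarith)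
      | (simp only [Prod.mk_sub_mk, Prod.mk.injEq, true_and]; omega)
  · exfalso
    have m₁ := hmin _ (toR_add_mem hv' hl)
    have m₂ := hmin _ (toR_add_mem hv hl')
    have hM : planeCross (toR d) (toR (v' + l)) = planeCross (toR d) (toR (v + l)) := by
      refine le_antisymm ?_ m₁
      rw [hxd'] at hcd
      simp only [toR_add, planeCross_add] at *
      linarith
    rcases htd.eq_of_supporting_line hd' hx hxd (toR_add_mem hv' hl) hmin hcd hM with h | h | h
    · exact hd (by simpa using h)
    · rw [hxd'] at h
      exact hll (add_left_cancel h).symm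
    · exact hvv (add_right_cancel h)

lemma snd_ge_of_mem {p q : ℤ} (hq : 0 < q) (hpq : q < p) {a b l : ℤ × ℤ} (hla : l.2 ≤ a.2)
    (hlb : l.2 ≤ b.2) {z : V} (hz : z ∈ GMSW p q + segment ℝ (toR a) (toR b)) :
    (toR l).2 ≤ z.2 := by
  rw [gmsw_add_segment] at hz
  have hc : ∀ w : V, planeCross (1, 0) w = w.2 := fun w => by simp [planeCross]
  rw [← hc z]
  refine le_planeCross_of_mem_convexHull ?_ hz
  rintro _ ⟨_, ⟨v, hv, rfl⟩, w, hw, rfl⟩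
  have hv2 : 0 ≤ v.2 := by
    rcases hv with rfl | rfl | rfl | rfl <;> simp only [] <;> omega
  dsimp only
  rw [hc]
  rcases hw with rfl | rfl <;> simp only [toR, Prod.snd_add] <;> norm_cast <;> omega

/-- A segment whose sum with `GMSW p q` is toric is not horizontal. -/
lemma snd_ne_snd_of_toric {p q : ℤ} (hq : 0 < q) (hpq : q < p) {a b : ℤ × ℤ} (hab : a ≠ b)
    (htd : IsToricDiagram (GMSW p q + segment ℝ (toR a) (toR b))) : a.2 ≠ b.2 := by
  intro h
  have hd : toR (1, 0) ≠ 0 := fun h0 => by simpa using toR_eq_zero.1 h0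
  have h0 : ((0, 0) : ℤ × ℤ) ∈ gmswVertices p q := by simp [gmswVertices]
  have h1 : ((1, 0) : ℤ × ℤ) ∈ gmswVertices p q := by simp [gmswVertices]
  have ha : a ∈ ({a, b} : Set (ℤ × ℤ)) := by simp
  have hb : b ∈ ({a, b} : Set (ℤ × ℤ)) := by simp
  have hmin : ∀ z ∈ GMSW p q + segment ℝ (toR a) (toR b),
      planeCross (toR (1, 0)) (toR ((0, 0) + a)) ≤ planeCross (toR (1, 0)) z := fun z hz => by
    simpa [planeCross, toR] using snd_ge_of_mem hq hpq le_rfl h.le hz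
  have t₁ := htd.eq_of_supporting_line hd (toR_add_mem h0 ha) (toR_add_mem h1 ha)
    (toR_add_mem h0 hb) hmin (by simp [planeCross, toR]) (by simp [planeCross, toR, h])
  have t₂ := htd.eq_of_supporting_line hd (toR_add_mem h0 ha) (toR_add_mem h1 ha)
    (toR_add_mem h1 hb) hmin (by simp [planeCross, toR]) (by simp [planeCross, toR, h])
  rw [Ne, Prod.ext_iff] at hab
  simp only [Prod.ext_iff, Prod.fst_add, Prod.snd_add] at t₁ t₂
  omega

/-- A segment whose sum with `GMSW p q` is toric is primitive. -/
lemma lt_two_of_toric {p q : ℤ} {a b e : ℤ × ℤ} {k : ℤ} (hab : a ≠ b)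
    (htd : IsToricDiagram (GMSW p q + segment ℝ (toR a) (toR b))) (h : b = a + k • e) :
    k < 2 := by
  by_contra! hk
  have he : e ≠ 0 := fun h0 => hab (by simp [h, h0])
  have hkR : (0 : ℝ) < k := by exact_mod_cast (by omega : 0 < k)
  have hk1 : (1 : ℝ) ≤ k := by exact_mod_cast (by omega : 1 ≤ k)
  have hd : toR e ≠ 0 := fun h0 => he (toR_eq_zero.1 h0)
  obtain ⟨v, hv, hvm⟩ := (gmsw_isLatticePolytope p q).hasLatticeMin (toR e)
  have hmem : toR (a + e) ∈ segment ℝ (toR a) (toR b) := by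
    refine ⟨1 - 1 / k, 1 / k, ?_, by positivity, by ring, ?_⟩
    · rw [sub_nonneg, div_le_one hkR]; exact hk1
    · subst h
      ext <;> simp [toR] <;> field_simp <;> ring
  have hca : planeCross (toR e) (toR b) = planeCross (toR e) (toR a) := by
    subst h; simp [planeCross, toR]; ring
  have hce : planeCross (toR e) (toR (a + e)) = planeCross (toR e) (toR a) := by
    simp [planeCross, toR]; ring
  have hX := add_mem_add hv (left_mem_segment ℝ (toR a) (toR b))
  have hY := add_mem_add hv hmem
  have hZ := add_mem_add hv (right_mem_segment ℝ (toR a) (toR b))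
  rw [← toR_add] at hX hY hZ
  have hmin : ∀ z ∈ GMSW p q + segment ℝ (toR a) (toR b),
      planeCross (toR e) (toR (v + a)) ≤ planeCross (toR e) z := by
    rintro _ ⟨x, hx, y, hy, rfl⟩
    dsimp only
    rw [toR_add, planeCross_add, planeCross_add]
    refine add_le_add (hvm x hx) ?_
    rw [← convexHull_pair] at hy
    refine le_planeCross_of_mem_convexHull ?_ hy
    rintro _ (rfl | rfl)
    · exact le_rfl
    · exact hca.ge
  rcases htd.eq_of_supporting_line hd hX hY hZ hmin
    (by simp only [toR_add, planeCross_add] at hce ⊢; linarith)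
    (by simp only [toR_add, planeCross_add] at hca ⊢; linarith) with h' | h' | h'
  · exact he (by simpa using h')
  · rw [h] at h'
    have h2 : (k - 1) • e = 0 := by
      rw [sub_smul, one_smul, sub_eq_zero]
      exact (add_left_cancel (add_left_cancel h')).symm
    rcases smul_eq_zero.1 h2 with h3 | h3
    · omega
    · exact he h3
  · exact hab (add_left_cancel h')

lemma vadd_segment_zero (t v : V) : t +ᵥ segment ℝ (toR (0, 0)) v = segment ℝ t (t + v) := by
  rw [vadd_segment, toR_eq_zero.2 Prod.mk_zero_zero]
  simp

lemma exists_translate_of_sub_eq {a b v : ℤ × ℤ} (h : b - a = v ∨ a - b = v) :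
    ∃ t : V, segment ℝ (toR a) (toR b) = t +ᵥ segment ℝ (toR (0, 0)) (toR v) := by
  rcases h with rfl | rfl
  · exact ⟨toR a, by rw [vadd_segment_zero, ← toR_add, add_sub_cancel]⟩
  · exact ⟨toR b, by rw [vadd_segment_zero, ← toR_add, add_sub_cancel, segment_symm]⟩

lemma left_mem_extremePoints_segment (x y : V) : x ∈ (segment ℝ x y).extremePoints ℝ := by
  refine ⟨left_mem_segment _ _ _, ?_⟩
  rintro _ ⟨r, s, -, hs, hrs, rfl⟩ _ ⟨r', s', -, hs', hrs', rfl⟩ ⟨α, β, hα, hβ, hαβ, h⟩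
  obtain rfl : r = 1 - s := by linarith
  obtain rfl : r' = 1 - s' := by linarith
  obtain rfl : α = 1 - β := by linarith
  have h' : ((1 - β) * s + β * s') • (y - x) = 0 := by
    rw [← sub_eq_zero] at h
    rw [← h]; module
  rcases smul_eq_zero.1 h' with h0 | h0
  · have : s = 0 := by nlinarith [mul_nonneg hα.le hs, mul_nonneg hβ.le hs']
    simp [this]
  · rw [sub_eq_zero.1 h0, ← add_smul]; simp

/-- A translate of a lattice segment that is itself a lattice segment is a lattice translate. -/
lemma exists_lattice_translate {L : Set V} (hL : IsLatticeSegment L) {v : ℤ × ℤ} {t : V}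
    (h : L = t +ᵥ segment ℝ (toR (0, 0)) (toR v)) :
    ∃ τ : ℤ × ℤ, L = segment ℝ (toR τ) (toR (τ + v)) := by
  obtain ⟨a, b, -, hab⟩ := hL
  rw [vadd_segment_zero] at h
  have ht := left_mem_extremePoints_segment t (t + toR v)
  rw [← h, hab, ← convexHull_pair] at ht
  rcases extremePoints_convexHull_subset ht with rfl | rfl
  · exact ⟨a, by rw [h, toR_add]⟩
  · exact ⟨b, by rw [h, toR_add]⟩

/-- If two lattice edges of `GMSW p q + L` close up a triangle with `(1, 0)`, then `L` is parallel
to the sum of two edges of `GMSW p q`. -/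
lemma sub_eq_of_closed_triangle {p q : ℤ} (hq : 0 < q) (hpq : q < p) {a b d₂ d₃ : ℤ × ℤ}
    (h₂ : (d₂ = (1, 0) ∨ d₂ = (p - 1, p) ∨ d₂ = (-q - 1, -q) ∨ d₂ = (q - p + 1, q - p)) ∨
      d₂ = b - a ∨ d₂ = a - b)
    (h₃ : (d₃ = (1, 0) ∨ d₃ = (p - 1, p) ∨ d₃ = (-q - 1, -q) ∨ d₃ = (q - p + 1, q - p)) ∨
      d₃ = b - a ∨ d₃ = a - b)
    (hsum : (1, 0) + d₂ + d₃ = 0) (hab : a.2 ≠ b.2) :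
    (b - a = (p, p) ∨ a - b = (p, p)) ∨ (b - a = (q, q) ∨ a - b = (q, q)) ∨
      (b - a = (-p + q + 2, -p + q) ∨ a - b = (-p + q + 2, -p + q)) := by
  obtain ⟨a₁, a₂⟩ := a
  obtain ⟨b₁, b₂⟩ := b
  obtain ⟨x₂, y₂⟩ := d₂
  obtain ⟨x₃, y₃⟩ := d₃
  simp only [Prod.mk_sub_mk, Prod.mk_add_mk, Prod.mk.injEq, Prod.mk_eq_zero] at *
  rcases h₂ with (h | h | h | h) | h | h <;> rcases h₃ with (h' | h' | h' | h') | h' | h' <;>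
    first
    | (exfalso; omega)
    | exact Or.inl (Or.inl (by omega))
    | exact Or.inl (Or.inr (by omega))
    | exact Or.inr (Or.inl (Or.inl (by omega)))
    | exact Or.inr (Or.inl (Or.inr (by omega)))
    | exact Or.inr (Or.inr (Or.inl (by omega)))
    | exact Or.inr (Or.inr (Or.inr (by omega)))

/-- Only two directions of `L` are compatible with a decomposition of `GMSW p q + L`. -/
lemma sub_eq_of_hasLatticeMaximalDecomposition {p q : ℤ} (hq : 0 < q) (hpq : q < p)
    {a b : ℤ × ℤ} (hab : a ≠ b) (htd : IsToricDiagram (GMSW p q + segment ℝ (toR a) (toR b)))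
    (hdec : HasLatticeMaximalDecomposition (GMSW p q + segment ℝ (toR a) (toR b))) :
    (q = 1 ∧ (b - a = (1, 1) ∨ a - b = (1, 1))) ∨
      (Odd (p - q) ∧ (b - a = (-p + q + 2, -p + q) ∨ a - b = (-p + q + 2, -p + q))) := by
  have hedge := fun d hd h => eq_of_isLatticeEdge hq hpq htd (d := d) hd h
  have hnh := snd_ne_snd_of_toric hq hpq hab htd
  obtain ⟨m, Ps, -, hsum, hPs⟩ := hdec
  have hmin : ∀ i, HasLatticeMin (Ps i) := fun i =>
    ((hPs i).elim IsLatticeSegment.isLatticePolytope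
      IsLatticeTriangle.isLatticePolytope).hasLatticeMin
  obtain ⟨l, hl, hla, hlb⟩ : ∃ l ∈ ({a, b} : Set (ℤ × ℤ)), l.2 ≤ a.2 ∧ l.2 ≤ b.2 := by
    rcases le_total a.2 b.2 with h | h
    · exact ⟨a, by simp, le_rfl, h⟩
    · exact ⟨b, by simp, h, le_rfl⟩
  have hlow := fun z hz => snd_ge_of_mem hq hpq hla hlb (z := z) hz
  have h₀ := toR_add_mem (p := p) (q := q) (v := (0, 0)) (by simp [gmswVertices]) hl
  have h₁ := toR_add_mem (p := p) (q := q) (v := (1, 0)) (by simp [gmswVertices]) hl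
  rw [hsum] at h₀ h₁ hlow
  obtain ⟨g₀, hg₀, hs₀⟩ := (Set.mem_fintype_sum _ _).1 h₀
  obtain ⟨g₁, hg₁, hs₁⟩ := (Set.mem_fintype_sum _ _).1 h₁
  obtain ⟨k, hk⟩ : ∃ k, g₀ k ≠ g₁ k := by
    by_contra! hall
    have : toR ((0, 0) + l) = toR ((1, 0) + l) := by
      rw [← hs₀, ← hs₁]; exact Finset.sum_congr rfl fun i _ => hall i
    simpa using toR_injective this
  have hE : ∀ d, d ≠ 0 → IsLatticeEdge (Ps k) d → _ := fun d hd h =>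
    hedge d hd (hsum ▸ IsLatticeEdge.sum hmin h)
  have hprim₁ := fun e c => lt_two_of_toric (e := e) (k := c) hab htd
  rw [segment_symm] at htd
  have hprim₂ := fun e c => lt_two_of_toric (e := e) (k := c) hab.symm htd
  rcases exists_edges_of_lowest_face (hPs k) (hg₀ k) (hg₁ k) hk
    (fun z hz => snd_le_of_sum_le hg₀ (fun w hw => by
      rw [hs₀]; simpa [toR] using hlow w hw) k hz)
    (fun z hz => snd_le_of_sum_le hg₁ (fun w hw => by
      rw [hs₁]; simpa [toR] using hlow w hw) k hz) with
    ⟨d, hd2, hd0, hd, hdn⟩ | ⟨d₁, d₂, d₃, hsum0, hd2, h10, h20, h30, hd₁, hd₂, hd₃⟩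
  · exfalso
    have e₁ := hE d hd0 hd
    have e₂ := hE (-d) (neg_ne_zero.2 hd0) hdn
    obtain ⟨d, d'⟩ := d
    simp only [Prod.ext_iff, Prod.fst_sub, Prod.snd_sub, Prod.fst_neg, Prod.snd_neg] at e₁ e₂ hd2
    omega
  · have e₁ := hE d₁ h10 hd₁
    have e₂ := hE d₂ h20 hd₂
    have e₃ := hE d₃ h30 hd₃
    obtain rfl : d₁ = (1, 0) := by
      simp only [Prod.ext_iff, Prod.fst_sub, Prod.snd_sub] at e₁ ⊢
      omega
    have hrep : ∀ {x y : ℤ × ℤ} {k u v : ℤ}, x - y = (k * u, k * v) → x = y + k • (u, v) :=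
      fun h => eq_add_of_sub_eq' h
    rcases sub_eq_of_closed_triangle hq hpq e₂ e₃ hsum0 hnh with (h | h) | (h | h) | (h | h)
    · have := hprim₁ (1, 1) p (hrep (by simpa using h)); omega
    · have := hprim₂ (1, 1) p (hrep (by simpa using h)); omega
    · have := hprim₁ (1, 1) q (hrep (by simpa using h))
      obtain rfl : q = 1 := by omega
      exact Or.inl ⟨rfl, Or.inl h⟩
    · have := hprim₂ (1, 1) q (hrep (by simpa using h))
      obtain rfl : q = 1 := by omega
      exact Or.inl ⟨rfl, Or.inr h⟩
    · refine Or.inr ⟨?_, Or.inl h⟩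
      by_contra hodd
      obtain ⟨r, hr⟩ := Int.not_odd_iff_even.1 hodd
      have := hprim₁ (-r + 1, -r) 2 (hrep (by rw [h, Prod.mk.injEq]; omega))
      omega
    · refine Or.inr ⟨?_, Or.inr h⟩
      by_contra hodd
      obtain ⟨r, hr⟩ := Int.not_odd_iff_even.1 hodd
      have := hprim₂ (-r + 1, -r) 2 (hrep (by rw [h, Prod.mk.injEq]; omega))
      omega

/-- Criterion for a sum of two triangles to equal `GMSW p q + L` in terms of sums of vertices. -/
lemma gmsw_add_segment_eq {p q : ℤ} {a b : ℤ × ℤ} {S T : Set V}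
    (h₁ : ∀ v ∈ gmswVertices p q, toR (v + a) ∈ convexHull ℝ S + convexHull ℝ T ∧
      toR (v + b) ∈ convexHull ℝ S + convexHull ℝ T)
    (h₂ : ∀ x ∈ S, ∀ y ∈ T, x + y ∈ GMSW p q + segment ℝ (toR a) (toR b)) :
    GMSW p q + segment ℝ (toR a) (toR b) = convexHull ℝ S + convexHull ℝ T := by
  refine Subset.antisymm ?_ ?_
  · rw [gmsw_add_segment]
    refine convexHull_min ?_ ((convex_convexHull ℝ _).add (convex_convexHull ℝ _))
    rintro _ ⟨_, ⟨v, hv, rfl⟩, l, hl, rfl⟩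
    dsimp only
    rcases hl with rfl | rfl <;> rw [← toR_add]
    · exact (h₁ v hv).1
    · exact (h₁ v hv).2
  · rw [← convexHull_add]
    refine convexHull_min ?_ ((convex_convexHull ℝ _).add (convex_segment _ _))
    rintro _ ⟨x, hx, y, hy, rfl⟩
    exact h₂ x hx y hy

lemma toR_mem_add_of_eq {S T : Set V} {x y z : ℤ × ℤ} (hx : toR x ∈ S) (hy : toR y ∈ T)
    (h : z = x + y) : toR z ∈ convexHull ℝ S + convexHull ℝ T := by
  rw [h, toR_add]
  exact add_mem_add (subset_convexHull ℝ S hx) (subset_convexHull ℝ T hy)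

lemma toR_add_toR_mem_of_eq {p q : ℤ} {a b v l x y : ℤ × ℤ} (hv : v ∈ gmswVertices p q)
    (hl : l ∈ ({a, b} : Set (ℤ × ℤ))) (h : x + y = v + l) :
    toR x + toR y ∈ GMSW p q + segment ℝ (toR a) (toR b) := by
  rw [← toR_add, h]
  exact toR_add_mem hv hl

lemma smul_diagonal_mem_gmsw {p q : ℤ} {r : ℝ} (h0 : 0 ≤ r) (h1 : r ≤ 1) :
    r • toR (p, p) ∈ GMSW p q := by
  have h := (convex_convexHull ℝ _ : Convex ℝ (GMSW p q))
    (toR_mem_gmsw (v := (0, 0)) (by simp [gmswVertices]))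
    (toR_mem_gmsw (v := (p, p)) (by simp [gmswVertices]))
    (sub_nonneg.2 h1) h0 (by ring)
  rwa [toR_eq_zero.2 Prod.mk_zero_zero, smul_zero, zero_add] at h

lemma gmsw_add_diagonal_eq {p : ℤ} (hp : 1 < p) (τ : ℤ × ℤ) :
    ∃ T₁ T₂ : Set V, IsLatticeTriangle T₁ ∧ IsLatticeTriangle T₂ ∧
      GMSW p 1 + segment ℝ (toR τ) (toR (τ + (1, 1))) = T₁ + T₂ := by
  refine ⟨_, _, ⟨τ, τ + (1, 0), τ + (2, 1), ?_, rfl⟩, ⟨(0, 0), (p - 1, p), (p - 2, p - 1), ?_, rfl⟩,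
    gmsw_add_segment_eq ?_ ?_⟩
  · rw [affineIndependent_iff_crossZ]; simp [crossZ]
  · rw [affineIndependent_iff_crossZ]
    have : crossZ ((p - 1, p) - (0, 0)) ((p - 2, p - 1) - (0, 0)) = 1 := by
      simp only [crossZ, Prod.mk_sub_mk]; ring
    rw [this]; exact one_ne_zero
  · rintro v (rfl | rfl | rfl | rfl) <;> refine ⟨?_, ?_⟩
    · exact toR_mem_add_of_eq (x := τ) (y := (0, 0)) (by simp) (by simp) (by ext <;> simp)
    · have hp0 : (0 : ℝ) < p := by exact_mod_cast (by omega : 0 < p)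
      have hp1 : (1 : ℝ) ≤ p := by exact_mod_cast hp.le
      have h := ((convex_convexHull ℝ _).add (convex_convexHull ℝ _) : Convex ℝ (_ + _))
        (toR_mem_add_of_eq (S := {toR τ, toR (τ + (1, 0)), toR (τ + (2, 1))})
          (T := {toR (0, 0), toR (p - 1, p), toR (p - 2, p - 1)}) (x := τ) (y := (0, 0))
          (by simp) (by simp) rfl)
        (toR_mem_add_of_eq (x := τ + (1, 0)) (y := (p - 1, p)) (by simp) (by simp) rfl)
        (sub_nonneg.2 ((div_le_one hp0).2 hp1)) (one_div_nonneg.2 hp0.le) (by ring)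
      convert h using 1
      ext <;> simp [toR] <;> field_simp <;> ring
    · exact toR_mem_add_of_eq (x := τ + (1, 0)) (y := (0, 0)) (by simp) (by simp)
        (by ext <;> simp <;> ring)
    · exact toR_mem_add_of_eq (x := τ + (2, 1)) (y := (0, 0)) (by simp) (by simp)
        (by ext <;> simp <;> ring)
    · exact toR_mem_add_of_eq (x := τ + (1, 0)) (y := (p - 1, p)) (by simp) (by simp)
        (by ext <;> simp <;> ring)
    · exact toR_mem_add_of_eq (x := τ + (2, 1)) (y := (p - 1, p)) (by simp) (by simp)
        (by ext <;> simp <;> ring)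
    · exact toR_mem_add_of_eq (x := τ) (y := (p - 2, p - 1)) (by simp) (by simp)
        (by ext <;> simp <;> ring)
    · exact toR_mem_add_of_eq (x := τ) (y := (p - 1, p)) (by simp) (by simp)
        (by ext <;> simp <;> ring)
  · rintro _ (rfl | rfl | rfl) _ (rfl | rfl | rfl)
    · exact toR_add_toR_mem_of_eq (v := (0, 0)) (l := τ) (by simp [gmswVertices]) (by simp)
        (by ext <;> simp)
    · exact toR_add_toR_mem_of_eq (v := (p - 1 - 1, p - 1)) (l := τ + (1, 1))
        (by simp [gmswVertices]) (by simp)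
        (by ext <;> simp <;> ring)
    · exact toR_add_toR_mem_of_eq (v := (p - 1 - 1, p - 1)) (l := τ)
        (by simp [gmswVertices]) (by simp)
        (by ext <;> simp <;> ring)
    · exact toR_add_toR_mem_of_eq (v := (1, 0)) (l := τ) (by simp [gmswVertices]) (by simp)
        (by ext <;> simp <;> ring)
    · exact toR_add_toR_mem_of_eq (v := (p, p)) (l := τ) (by simp [gmswVertices]) (by simp)
        (by ext <;> simp <;> ring)
    · have hp0 : (0 : ℝ) < p := by exact_mod_cast (by omega : 0 < p)
      have hp1 : (1 : ℝ) ≤ p := by exact_mod_cast hp.le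
      refine ⟨_, smul_diagonal_mem_gmsw (r := ((p : ℝ) - 1) / p)
        (div_nonneg (by linarith) hp0.le) ((div_le_one hp0).2 (by linarith)),
        _, left_mem_segment _ _ _, ?_⟩
      ext <;> simp [toR] <;> field_simp <;> ring
    · exact toR_add_toR_mem_of_eq (v := (1, 0)) (l := τ + (1, 1)) (by simp [gmswVertices]) (by simp)
        (by ext <;> simp <;> ring)
    · exact toR_add_toR_mem_of_eq (v := (p, p)) (l := τ + (1, 1)) (by simp [gmswVertices]) (by simp)
        (by ext <;> simp <;> ring)
    · exact toR_add_toR_mem_of_eq (v := (p, p)) (l := τ) (by simp [gmswVertices]) (by simp)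
        (by ext <;> simp <;> ring)

lemma gmsw_add_short_diagonal_eq {p q : ℤ} (hq : 0 < q) (hpq : q < p) (τ : ℤ × ℤ) :
    ∃ T₁ T₂ : Set V, IsLatticeTriangle T₁ ∧ IsLatticeTriangle T₂ ∧
      GMSW p q + segment ℝ (toR τ) (toR (τ + (-p + q + 2, -p + q))) = T₁ + T₂ := by
  refine ⟨_, _, ⟨τ, τ + (-(p - q - 1), -(p - q)), τ + (-p + q + 2, -p + q), ?_, rfl⟩,
    ⟨(1, 0), (p, p), (p - q - 1, p - q), ?_, rfl⟩, gmsw_add_segment_eq ?_ ?_⟩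
  · rw [affineIndependent_iff_crossZ, add_sub_cancel_left, add_sub_cancel_left]
    simp only [crossZ]
    exact ne_of_gt (by linarith)
  · rw [affineIndependent_iff_crossZ]
    simp only [crossZ, Prod.mk_sub_mk]
    exact ne_of_gt (by linarith)
  · rintro v (rfl | rfl | rfl | rfl) <;> refine ⟨?_, ?_⟩
    · exact toR_mem_add_of_eq (x := τ + (-(p - q - 1), -(p - q))) (y := (p - q - 1, p - q))
        (by simp) (by simp) (by ext <;> simp <;> ring)
    · exact toR_mem_add_of_eq (x := τ + (-(p - q - 1), -(p - q))) (y := (1, 0)) (by simp) (by simp)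
        (by ext <;> simp <;> ring)
    · exact toR_mem_add_of_eq (x := τ) (y := (1, 0)) (by simp) (by simp) (by ext <;> simp <;> ring)
    · exact toR_mem_add_of_eq (x := τ + (-p + q + 2, -p + q)) (y := (1, 0)) (by simp) (by simp)
        (by ext <;> simp <;> ring)
    · exact toR_mem_add_of_eq (x := τ) (y := (p, p)) (by simp) (by simp) (by ext <;> simp <;> ring)
    · exact toR_mem_add_of_eq (x := τ + (-p + q + 2, -p + q)) (y := (p, p)) (by simp) (by simp)
        (by ext <;> simp <;> ring)
    · exact toR_mem_add_of_eq (x := τ) (y := (p - q - 1, p - q)) (by simp) (by simp)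
        (by ext <;> simp <;> ring)
    · exact toR_mem_add_of_eq (x := τ + (-p + q + 2, -p + q)) (y := (p - q - 1, p - q))
        (by simp) (by simp) (by ext <;> simp <;> ring)
  · rintro _ (rfl | rfl | rfl) _ (rfl | rfl | rfl)
    · exact toR_add_toR_mem_of_eq (v := (1, 0)) (l := τ) (by simp [gmswVertices]) (by simp)
        (by ext <;> simp <;> ring)
    · exact toR_add_toR_mem_of_eq (v := (p, p)) (l := τ) (by simp [gmswVertices]) (by simp)
        (by ext <;> simp <;> ring)
    · exact toR_add_toR_mem_of_eq (v := (p - q - 1, p - q)) (l := τ)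
        (by simp [gmswVertices]) (by simp)
        (by ext <;> simp <;> ring)
    · exact toR_add_toR_mem_of_eq (v := (0, 0)) (l := τ + (-p + q + 2, -p + q))
        (by simp [gmswVertices]) (by simp)
        (by ext <;> simp <;> ring)
    · have hq0 : (0 : ℝ) < q := by exact_mod_cast hq
      have hpq' : (q : ℝ) < p := by exact_mod_cast hpq
      have hp0 : (0 : ℝ) < p := hq0.trans hpq'
      refine ⟨_, smul_diagonal_mem_gmsw (r := ((p : ℝ) + q) / (2 * p)) (by positivity)
        ((div_le_one (by positivity)).2 (by linarith)),
        _, ⟨1 / 2, 1 / 2, by norm_num, by norm_num, by norm_num, rfl⟩, ?_⟩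
      ext <;> simp [toR] <;> field_simp <;> ring
    · exact toR_add_toR_mem_of_eq (v := (0, 0)) (l := τ) (by simp [gmswVertices]) (by simp)
        (by ext <;> simp <;> ring)
    · exact toR_add_toR_mem_of_eq (v := (1, 0)) (l := τ + (-p + q + 2, -p + q))
        (by simp [gmswVertices]) (by simp)
        (by ext <;> simp <;> ring)
    · exact toR_add_toR_mem_of_eq (v := (p, p)) (l := τ + (-p + q + 2, -p + q))
        (by simp [gmswVertices]) (by simp)
        (by ext <;> simp <;> ring)
    · exact toR_add_toR_mem_of_eq (v := (p - q - 1, p - q)) (l := τ + (-p + q + 2, -p + q))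
        (by simp [gmswVertices]) (by simp)
        (by ext <;> simp <;> ring)

/-- Let `p > q > 0` and let `L` be a lattice segment with `𝒴^{p,q} + L` a
toric diagram. Then `𝒴^{p,q} + L` admits a lattice maximal Minkowski decomposition iff
either `q = 1` and `L` is a translate of `conv{(0,0),(1,1)}`, or `p − q` is odd and `L` is
a translate of `conv{(0,0),(−p+q+2,−p+q)}`; in both cases `𝒴^{p,q} + L` is the Minkowski
sum of two lattice triangles. -/
theorem statement12 (p q : ℤ) (hq : 0 < q) (hpq : q < p)
    (L : Set V) (hL : IsLatticeSegment L)
    (htd : IsToricDiagram (GMSW p q + L)) :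
    (HasLatticeMaximalDecomposition (GMSW p q + L) ↔
      ((q = 1 ∧ ∃ t : V, L = t +ᵥ segment ℝ (toR (0, 0)) (toR (1, 1))) ∨
       (Odd (p - q) ∧
         ∃ t : V, L = t +ᵥ segment ℝ (toR (0, 0)) (toR (-p + q + 2, -p + q))))) ∧
    (((q = 1 ∧ ∃ t : V, L = t +ᵥ segment ℝ (toR (0, 0)) (toR (1, 1))) ∨
       (Odd (p - q) ∧
         ∃ t : V, L = t +ᵥ segment ℝ (toR (0, 0)) (toR (-p + q + 2, -p + q)))) →
      ∃ T₁ T₂ : Set V, IsLatticeTriangle T₁ ∧ IsLatticeTriangle T₂ ∧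
        GMSW p q + L = T₁ + T₂) := by
  have hdec : ((q = 1 ∧ ∃ t : V, L = t +ᵥ segment ℝ (toR (0, 0)) (toR (1, 1))) ∨
       (Odd (p - q) ∧
         ∃ t : V, L = t +ᵥ segment ℝ (toR (0, 0)) (toR (-p + q + 2, -p + q)))) →
      ∃ T₁ T₂ : Set V, IsLatticeTriangle T₁ ∧ IsLatticeTriangle T₂ ∧
        GMSW p q + L = T₁ + T₂ := by
    rintro (⟨rfl, t, ht⟩ | ⟨-, t, ht⟩)
    · obtain ⟨τ, rfl⟩ := exists_lattice_translate hL ht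
      exact gmsw_add_diagonal_eq hpq τ
    · obtain ⟨τ, rfl⟩ := exists_lattice_translate hL ht
      exact gmsw_add_short_diagonal_eq hq hpq τ
  refine ⟨⟨fun h => ?_, fun h => ?_⟩, hdec⟩
  · obtain ⟨a, b, hab, rfl⟩ := hL
    exact (sub_eq_of_hasLatticeMaximalDecomposition hq hpq hab htd h).imp
      (And.imp_right exists_translate_of_sub_eq) (And.imp_right exists_translate_of_sub_eq)
  · obtain ⟨T₁, T₂, h₁, h₂, h⟩ := hdec h
    refine ⟨1, ![T₁, T₂], le_rfl, by simpa using h, fun k => Or.inr ?_⟩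
    fin_cases k
    · exact h₁
    · exact h₂
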